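/- Let δ : [0,1] → ℝ be a diagonal function (δ(0) = 0, δ(1) = 1, δ(t) ≤ t, δ nondecreasing, 2-Lipschitz) with δ(t) ≤ t² for all t, t ↦ δ(t)/t² nondecreasing on (0,1], and t ↦ t + √(t² − δ(t)) nondecreasing on [0,1]. Suppose there is a ∈ (0,1) such that δ(t) = 0 for t ∈ [0,a] and δ(t) > 0 for t ∈ (a,1]. Define h(0) = 0, h(t) = 2a − t for t ∈ (0,a], h(t) = √(t² − δ(t)) for t ∈ (a,1], and f(t) = √(t² − δ(t)) for all t ∈ [0,1]. Then: (i) the pairs (h, h) and (f, f) both satisfy conditions (G1)–(G3) and the SRMM copulas C_h and C_f both have diagonal section δ; (ii) if g : [0,1] → ℝ is any function with (g, g) satisfying (G1)–(G3) and max{0, t² − g(t)²} = δ(t) for all t, then max{0, uv − h(u)h(v)} ≤ max{0, uv − g(u)g(v)} ≤ max{0, uv − f(u)f(v)} for all u, v ∈ [0,1]. -/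

import Mathlib

/-- Conditions (G1)–(G3) for a pair of generators of a reflected maxmin copula:
(G1) `f` and `g` are nonnegative on `[0,1]` and vanish at `0` and `1`;
(G2) `u ↦ f u + u` and `v ↦ g v + v` are nondecreasing on `[0,1]`;
(G3) `u ↦ f u / u` and `v ↦ g v / v` are nonincreasing on `(0,1]`. -/
def CondG (f g : ℝ → ℝ) : Prop :=
  (∀ u ∈ Set.Icc (0:ℝ) 1, 0 ≤ f u) ∧ (∀ v ∈ Set.Icc (0:ℝ) 1, 0 ≤ g v) ∧
  f 0 = 0 ∧ g 0 = 0 ∧ f 1 = 0 ∧ g 1 = 0 ∧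
  (∀ u₁ ∈ Set.Icc (0:ℝ) 1, ∀ u₂ ∈ Set.Icc (0:ℝ) 1, u₁ ≤ u₂ → f u₁ + u₁ ≤ f u₂ + u₂) ∧
  (∀ v₁ ∈ Set.Icc (0:ℝ) 1, ∀ v₂ ∈ Set.Icc (0:ℝ) 1, v₁ ≤ v₂ → g v₁ + v₁ ≤ g v₂ + v₂) ∧
  (∀ u₁ ∈ Set.Ioc (0:ℝ) 1, ∀ u₂ ∈ Set.Ioc (0:ℝ) 1, u₁ ≤ u₂ → f u₂ / u₂ ≤ f u₁ / u₁) ∧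
  (∀ v₁ ∈ Set.Ioc (0:ℝ) 1, ∀ v₂ ∈ Set.Ioc (0:ℝ) 1, v₁ ≤ v₂ → g v₂ / v₂ ≤ g v₁ / v₁)

theorem condG_self {f : ℝ → ℝ} (hnn : ∀ u ∈ Set.Icc (0:ℝ) 1, 0 ≤ f u) (h0 : f 0 = 0) (h1 : f 1 = 0)
    (hadd : ∀ u₁ ∈ Set.Icc (0:ℝ) 1, ∀ u₂ ∈ Set.Icc (0:ℝ) 1, u₁ ≤ u₂ → f u₁ + u₁ ≤ f u₂ + u₂)
    (hdiv : ∀ u₁ ∈ Set.Ioc (0:ℝ) 1, ∀ u₂ ∈ Set.Ioc (0:ℝ) 1, u₁ ≤ u₂ → f u₂ / u₂ ≤ f u₁ / u₁) :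
    CondG f f :=
  ⟨hnn, hnn, h0, h0, h1, h1, hadd, hadd, hdiv, hdiv⟩

theorem sqrt_sq_sub_div_self {t d : ℝ} (ht : 0 < t) :
    Real.sqrt (t ^ 2 - d) / t = Real.sqrt (1 - d / t ^ 2) := by
  rw [show 1 - d / t ^ 2 = (t ^ 2 - d) / t ^ 2 by field_simp, Real.sqrt_div' _ (sq_nonneg t),
    Real.sqrt_sq ht.le]

/-- Pointwise order of nonnegative generators reverses the order of the induced copulas. -/
theorem max_mul_sub_mul_anti {f g : ℝ → ℝ} {u v : ℝ} (hfv : 0 ≤ f v) (hgu : 0 ≤ g u)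
    (hu : f u ≤ g u) (hv : f v ≤ g v) :
    max 0 (u * v - g u * g v) ≤ max 0 (u * v - f u * f v) :=
  max_le_max_left _ (sub_le_sub_left (mul_le_mul hu hv hfv hgu) _)

/-- Bounds for SRMM copulas with a given diagonal section `δ` vanishing exactly on
`[0,a]`: the generators `h` (with `h t = 2a - t` on `(0,a]`, `√(t² - δ t)` on `(a,1]`)
and `f t = √(t² - δ t)` both generate SRMM copulas with diagonal `δ`, and every SRMM
copula with diagonal `δ` lies between `C_h` and `C_f`. -/
theorem srmm_bounds_for_diagonal (δ : ℝ → ℝ) (a : ℝ) (ha : a ∈ Set.Ioo (0:ℝ) 1)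
    (hδ0 : δ 0 = 0) (hδ1 : δ 1 = 1)
    (hδle : ∀ t ∈ Set.Icc (0:ℝ) 1, δ t ≤ t)
    (hδmono : ∀ s ∈ Set.Icc (0:ℝ) 1, ∀ t ∈ Set.Icc (0:ℝ) 1, s ≤ t → δ s ≤ δ t)
    (hδlip : ∀ s ∈ Set.Icc (0:ℝ) 1, ∀ t ∈ Set.Icc (0:ℝ) 1, |δ s - δ t| ≤ 2 * |s - t|)
    (hδsq : ∀ t ∈ Set.Icc (0:ℝ) 1, δ t ≤ t ^ 2)
    (hsharp : ∀ t₁ ∈ Set.Ioc (0:ℝ) 1, ∀ t₂ ∈ Set.Ioc (0:ℝ) 1, t₁ ≤ t₂ →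
      δ t₁ / t₁ ^ 2 ≤ δ t₂ / t₂ ^ 2)
    (hhat : ∀ t₁ ∈ Set.Icc (0:ℝ) 1, ∀ t₂ ∈ Set.Icc (0:ℝ) 1, t₁ ≤ t₂ →
      t₁ + Real.sqrt (t₁ ^ 2 - δ t₁) ≤ t₂ + Real.sqrt (t₂ ^ 2 - δ t₂))
    (hzero : ∀ t ∈ Set.Icc (0:ℝ) a, δ t = 0)
    (hpos : ∀ t ∈ Set.Ioc a 1, 0 < δ t)
    (h f : ℝ → ℝ)
    (hh0 : h 0 = 0)
    (hh1 : ∀ t : ℝ, 0 < t → t ≤ a → h t = 2 * a - t)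
    (hh2 : ∀ t : ℝ, a < t → t ≤ 1 → h t = Real.sqrt (t ^ 2 - δ t))
    (hf : ∀ t : ℝ, f t = Real.sqrt (t ^ 2 - δ t)) :
    (CondG h h ∧ CondG f f) ∧
    (∀ t ∈ Set.Icc (0:ℝ) 1, max 0 (t ^ 2 - h t ^ 2) = δ t) ∧
    (∀ t ∈ Set.Icc (0:ℝ) 1, max 0 (t ^ 2 - f t ^ 2) = δ t) ∧
    (∀ g : ℝ → ℝ, CondG g g →
      (∀ t ∈ Set.Icc (0:ℝ) 1, max 0 (t ^ 2 - g t ^ 2) = δ t) →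
      ∀ u ∈ Set.Icc (0:ℝ) 1, ∀ v ∈ Set.Icc (0:ℝ) 1,
        max 0 (u * v - h u * h v) ≤ max 0 (u * v - g u * g v) ∧
        max 0 (u * v - g u * g v) ≤ max 0 (u * v - f u * f v)) := by
  obtain ⟨ha0, ha1⟩ := ha
  have f_nonneg : ∀ t, 0 ≤ f t := fun t => by rw [hf]; positivity
  have f_sq : ∀ t ∈ Set.Icc (0:ℝ) 1, f t ^ 2 = t ^ 2 - δ t := fun t ht => by
    rw [hf, Real.sq_sqrt (sub_nonneg.2 (hδsq t ht))]
  have δ_nonneg : ∀ t ∈ Set.Icc (0:ℝ) 1, 0 ≤ δ t := fun t ht => by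
    rcases le_or_gt t a with h | h
    · exact (hzero t ⟨ht.1, h⟩).ge
    · exact (hpos t ⟨h, ht.2⟩).le
  have f_le : ∀ t ∈ Set.Icc (0:ℝ) 1, f t ≤ t := fun t ht =>
    abs_le_of_sq_le_sq' (by linarith [f_sq t ht, δ_nonneg t ht]) ht.1 |>.2
  have f_eq : ∀ t ∈ Set.Icc (0:ℝ) a, f t = t := fun t ht => by
    rw [hf, hzero t ht, sub_zero, Real.sqrt_sq ht.1]
  have h_eq : ∀ t : ℝ, a < t → t ≤ 1 → h t = f t := fun t h₁ h₂ => by rw [hh2 t h₁ h₂, hf]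
  have f_one : f 1 = 0 := by rw [hf, hδ1]; simp
  have f_add : ∀ u₁ ∈ Set.Icc (0:ℝ) 1, ∀ u₂ ∈ Set.Icc (0:ℝ) 1, u₁ ≤ u₂ →
      f u₁ + u₁ ≤ f u₂ + u₂ := fun u₁ h₁ u₂ h₂ h₁₂ => by
    have := hhat u₁ h₁ u₂ h₂ h₁₂
    rw [hf, hf]
    linarith
  have f_div : ∀ u₁ ∈ Set.Ioc (0:ℝ) 1, ∀ u₂ ∈ Set.Ioc (0:ℝ) 1, u₁ ≤ u₂ →
      f u₂ / u₂ ≤ f u₁ / u₁ := fun u₁ h₁ u₂ h₂ h₁₂ => by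
    rw [hf, hf, sqrt_sq_sub_div_self h₁.1, sqrt_sq_sub_div_self h₂.1]
    exact Real.sqrt_le_sqrt (sub_le_sub_left (hsharp u₁ h₁ u₂ h₂ h₁₂) 1)
  have f_diag : ∀ t ∈ Set.Icc (0:ℝ) 1, max 0 (t ^ 2 - f t ^ 2) = δ t := fun t ht => by
    rw [f_sq t ht, sub_sub_cancel, max_eq_right (δ_nonneg t ht)]
  have h_nonneg : ∀ t ∈ Set.Icc (0:ℝ) 1, 0 ≤ h t := fun t ht => by
    rcases ht.1.eq_or_lt with rfl | h0
    · exact hh0.ge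
    rcases le_or_gt t a with hta | hta
    · rw [hh1 t h0 hta]; linarith
    · rw [h_eq t hta ht.2]; exact f_nonneg t
  have h_add : ∀ u₁ ∈ Set.Icc (0:ℝ) 1, ∀ u₂ ∈ Set.Icc (0:ℝ) 1, u₁ ≤ u₂ →
      h u₁ + u₁ ≤ h u₂ + u₂ := fun u₁ h₁ u₂ h₂ h₁₂ => by
    rcases h₁.1.eq_or_lt with rfl | h0
    · rw [hh0]; linarith [h_nonneg u₂ h₂]
    rcases le_or_gt u₁ a with h₁a | h₁a
    · rw [hh1 u₁ h0 h₁a]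
      rcases le_or_gt u₂ a with h₂a | h₂a
      · rw [hh1 u₂ (h0.trans_le h₁₂) h₂a]; linarith
      · rw [h_eq u₂ h₂a h₂.2]
        linarith [f_add a ⟨ha0.le, ha1.le⟩ u₂ h₂ h₂a.le, f_eq a ⟨ha0.le, le_rfl⟩]
    · rw [h_eq u₁ h₁a h₁.2, h_eq u₂ (h₁a.trans_le h₁₂) h₂.2]
      exact f_add u₁ h₁ u₂ h₂ h₁₂
  have h_div : ∀ u₁ ∈ Set.Ioc (0:ℝ) 1, ∀ u₂ ∈ Set.Ioc (0:ℝ) 1, u₁ ≤ u₂ →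
      h u₂ / u₂ ≤ h u₁ / u₁ := fun u₁ h₁ u₂ h₂ h₁₂ => by
    rcases le_or_gt u₁ a with h₁a | h₁a
    · rw [hh1 u₁ h₁.1 h₁a, div_le_div_iff₀ h₂.1 h₁.1]
      rcases le_or_gt u₂ a with h₂a | h₂a
      · rw [hh1 u₂ h₂.1 h₂a]; nlinarith
      · rw [h_eq u₂ h₂a h₂.2]
        have := f_le u₂ ⟨h₂.1.le, h₂.2⟩
        nlinarith [h₁.1, h₂.1]
    · rw [h_eq u₁ h₁a h₁.2, h_eq u₂ (h₁a.trans_le h₁₂) h₂.2]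
      exact f_div u₁ h₁ u₂ h₂ h₁₂
  have h_diag : ∀ t ∈ Set.Icc (0:ℝ) 1, max 0 (t ^ 2 - h t ^ 2) = δ t := fun t ht => by
    rcases ht.1.eq_or_lt with rfl | h0
    · simp [hh0, hδ0]
    rcases le_or_gt t a with hta | hta
    · rw [hh1 t h0 hta, hzero t ⟨ht.1, hta⟩]
      exact max_eq_left (by nlinarith)
    · rw [h_eq t hta ht.2]; exact f_diag t ht
  refine ⟨⟨condG_self h_nonneg hh0 ((h_eq 1 ha1 le_rfl).trans f_one) h_add h_div,
    condG_self (fun t _ => f_nonneg t) (f_eq 0 ⟨le_rfl, ha0.le⟩) f_one f_add f_div⟩,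
    h_diag, f_diag, ?_⟩
  rintro g ⟨g_nonneg, -, g_zero, -, -, -, g_add, -, -, -⟩ g_diag u hu v hv
  have g_eq : ∀ t : ℝ, a < t → t ≤ 1 → g t = f t := fun t hta ht1 => by
    have ht : t ∈ Set.Icc (0:ℝ) 1 := ⟨ha0.le.trans hta.le, ht1⟩
    have hd := g_diag t ht
    rcases max_cases 0 (t ^ 2 - g t ^ 2) with ⟨h₁, -⟩ | ⟨h₁, -⟩
    · linarith [hpos t ⟨hta, ht1⟩]
    · rw [hf, ← hd, h₁, sub_sub_cancel, Real.sqrt_sq (g_nonneg t ht)]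
  have f_le_g : ∀ t ∈ Set.Icc (0:ℝ) 1, f t ≤ g t := fun t ht => by
    refine abs_le_of_sq_le_sq' ?_ (g_nonneg t ht) |>.2
    linarith [f_sq t ht, g_diag t ht, le_max_right 0 (t ^ 2 - g t ^ 2)]
  have g_le_h : ∀ t ∈ Set.Icc (0:ℝ) 1, g t ≤ h t := fun t ht => by
    rcases ht.1.eq_or_lt with rfl | h0
    · rw [g_zero, hh0]
    rcases le_or_gt t a with hta | hta
    · rw [hh1 t h0 hta]
      by_contra! hlt
      obtain ⟨s, has, hs⟩ := exists_between (lt_min ha1 (show a < (g t + t) / 2 by linarith))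
      obtain ⟨hs1, hs2⟩ := lt_min_iff.1 hs
      have hsI : s ∈ Set.Icc (0:ℝ) 1 := ⟨by linarith, hs1.le⟩
      have := g_add t ht s hsI (by linarith)
      rw [g_eq s has hs1.le] at this
      linarith [f_le s hsI]
    · rw [g_eq t hta ht.2, h_eq t hta ht.2]
  exact ⟨max_mul_sub_mul_anti (g_nonneg v hv) (h_nonneg u hu) (g_le_h u hu) (g_le_h v hv),
    max_mul_sub_mul_anti (f_nonneg v) (g_nonneg u hu) (f_le_g u hu) (f_le_g v hv)⟩
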